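/- arXiv:2110.05918 — 3 statements merged into one kernel-verified Lean document; each statement's English description precedes it below -/
import Mathlib

section
/- Let ε_n denote the minimal logarithmic energy of n pairwise distinct points in [-1,1]. Then the quantity ε_n - (log 2)·n² + n·log n + 2·(log 2)·n + (1/4)·log n is bounded as n → ∞; that is, there exist constants C > 0 and N such that |ε_n - (log 2)·n² + n·log n + 2·(log 2)·n + (1/4)·log n| ≤ C for all n ≥ N. -/
open Real MeasureTheory Finset

/-- The logarithmic energy of `n` points `x 0, …, x (n-1)`:
`E_log(x) = -∑_{i ≠ j} log |x i - x j|` (sum over ordered pairs). -/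
noncomputable def Elog (n : ℕ) (x : Fin n → ℝ) : ℝ :=
  -∑ i : Fin n, ∑ j : Fin n, if i ≠ j then Real.log |x i - x j| else 0

/-- The minimal logarithmic energy of `n` pairwise distinct points in `[-1,1]`. -/
noncomputable def minEnergy (n : ℕ) : ℝ :=
  sInf {E : ℝ | ∃ x : Fin n → ℝ, (∀ i, x i ∈ Set.Icc (-1 : ℝ) 1) ∧
    Function.Injective x ∧ E = Elog n x}

open Polynomial in
noncomputable def monLeg : ℕ → Polynomial ℝ
  | 0 => 1
  | 1 => X
  | (k+2) => X * monLeg (k+1) - C (((k:ℝ)+1)^2/((2*k+1)*(2*k+3))) * monLeg k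

noncomputable def bL (k : ℕ) : ℝ := ((k:ℝ)+1)^2/((2*k+1)*(2*k+3))
noncomputable def cL (k : ℕ) : ℝ := ((k:ℝ)+1)/(2*k+1)

lemma bL_pos (k : ℕ) : 0 < bL k := by unfold bL; positivity
lemma cL_pos (k : ℕ) : 0 < cL k := by unfold cL; positivity

section
open Polynomial

lemma monLeg_succ (k : ℕ) :
    monLeg (k+2) = X * monLeg (k+1) - C (bL k) * monLeg k := by
  rw [monLeg]; rfl

lemma monic_X_mul_sub {p q : ℝ[X]} {k : ℕ} (hp : p.Monic) (hpd : p.natDegree = k+1)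
    (hq : q.natDegree = k) (c : ℝ) :
    (X * p - C c * q).Monic ∧ (X * p - C c * q).natDegree = k + 2 := by
  have h1 : (X * p).Monic := monic_X.mul hp
  have h2 : (X * p).natDegree = k + 2 := by
    rw [monic_X.natDegree_mul hp, hpd, natDegree_X]; ring
  have h3 : (C c * q).natDegree < (X * p).natDegree :=
    lt_of_le_of_lt (natDegree_C_mul_le _ _) (by omega)
  have h4 : (C c * q).degree < (X * p).degree := degree_lt_degree h3
  exact ⟨h1.sub_of_left h4, by rw [natDegree_sub_eq_left_of_natDegree_lt h3, h2]⟩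

lemma monLeg_monic (k : ℕ) : ((monLeg k).Monic ∧ (monLeg k).natDegree = k) ∧
    ((monLeg (k+1)).Monic ∧ (monLeg (k+1)).natDegree = k+1) := by
  induction k with
  | zero => simp [monLeg, monic_X]
  | succ k ih =>
    refine ⟨ih.2, ?_⟩
    rw [monLeg_succ]
    exact monic_X_mul_sub ih.2.1 ih.2.2 ih.1.2 _

lemma monLeg_ids (k : ℕ) :
    X * derivative (monLeg (k+1)) - C (cL k) * derivative (monLeg k)
      = C ((k:ℝ)+1) * monLeg (k+1) ∧
    (X^2 - 1) * derivative (monLeg (k+1))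
      = C ((k:ℝ)+1) * (X * monLeg (k+1) - C (cL k) * monLeg k) := by
  induction k with
  | zero => simp [monLeg, cL]; ring
  | succ k ih =>
    obtain ⟨h1, h2⟩ := ih
    have hb : bL k = cL k * (((k:ℝ)+1)/(2*k+3)) := by unfold bL cL; field_simp
    have hd : derivative (monLeg (k+2)) = C (cL (k+1)) *
        (C ((k:ℝ)+2) * monLeg (k+1) + X * derivative (monLeg (k+1))) := by
      rw [monLeg_succ]
      simp only [derivative_sub, derivative_mul, derivative_X, derivative_C, zero_mul, zero_add,
        one_mul]
      have h1' : C (cL k) * derivative (monLeg k) =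
        X * derivative (monLeg (k+1)) - C ((k:ℝ)+1) * monLeg (k+1) := by rw [← h1]; ring
      have e1 : C (bL k) * derivative (monLeg k) = C (((k:ℝ)+1)/(2*k+3)) *
        (X * derivative (monLeg (k+1)) - C ((k:ℝ)+1) * monLeg (k+1)) := by
        rw [← h1', hb, C_mul]; ring
      rw [e1]
      have e2 : (C (cL (k+1)) : ℝ[X]) = 1 - C (((k:ℝ)+1)/(2*k+3)) := by
        rw [← C_1, ← C_sub]; congr 1; unfold cL; push_cast; field_simp; ring
      have e3 : (C (cL (k+1)) * C ((k:ℝ)+2) : ℝ[X]) =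
          1 + C (((k:ℝ)+1)/(2*k+3)) * C ((k:ℝ)+1) := by
        rw [← C_1, ← C_mul, ← C_mul, ← C_add]; congr 1; unfold cL; push_cast; field_simp; ring
      calc _ = (1 + C (((k:ℝ)+1)/(2*k+3)) * C ((k:ℝ)+1)) * monLeg (k+1)
            + (1 - C (((k:ℝ)+1)/(2*k+3))) * (X * derivative (monLeg (k+1))) := by ring
        _ = _ := by rw [← e2, ← e3]; ring
    have f1 : (C (cL (k+1)) * (C ((k:ℝ)+2) + C ((k:ℝ)+1)) : ℝ[X]) = C ((k:ℝ)+2) := by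
      rw [← C_add, ← C_mul]; congr 1; unfold cL; push_cast; field_simp; ring
    have f2 : (C (cL (k+1)) * C ((k:ℝ)+1) * C (cL k) : ℝ[X]) = C ((k:ℝ)+2) * C (bL k) := by
      rw [← C_mul, ← C_mul, ← C_mul]; congr 1; unfold cL bL; push_cast; field_simp; ring
    have hk : (C (((k+1:ℕ):ℝ)+1) : ℝ[X]) = C ((k:ℝ)+2) := by congr 1; push_cast; ring
    rw [hk, hd, monLeg_succ]
    constructor
    · linear_combination C (cL (k+1)) * h2 + X * monLeg (k+1) * f1 - monLeg k * f2
    · linear_combination C (cL (k+1)) * X * h2 + X^2 * monLeg (k+1) * f1 - X * monLeg k * f2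

noncomputable def fekPoly (k : ℕ) : ℝ[X] := X * monLeg (k+1) - C (cL k) * monLeg k

lemma fekPoly_monic (k : ℕ) : (fekPoly k).Monic ∧ (fekPoly k).natDegree = k + 2 :=
  monic_X_mul_sub (monLeg_monic k).2.1 (monLeg_monic k).2.2 (monLeg_monic k).1.2 _

lemma fekPoly_deriv (k : ℕ) : derivative (fekPoly k) = C ((k:ℝ)+2) * monLeg (k+1) := by
  have h := (monLeg_ids k).1
  unfold fekPoly
  simp only [derivative_sub, derivative_mul, derivative_X, derivative_C, zero_mul, zero_add,
        one_mul]
  have : (C ((k:ℝ)+2) : ℝ[X]) = C ((k:ℝ)+1) + 1 := by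
    rw [← C_1, ← C_add]; congr 1; ring
  rw [this]
  linear_combination h

lemma fekPoly_ode (k : ℕ) : (X^2 - 1) * derivative (derivative (fekPoly k)) =
    C (((k:ℝ)+2)*((k:ℝ)+1)) * fekPoly k := by
  have h := (monLeg_ids k).2
  rw [fekPoly_deriv, derivative_mul, derivative_C, C_mul]
  unfold fekPoly
  linear_combination C ((k:ℝ)+2) * h

lemma coeff_ode (Q : ℝ[X]) (d : ℕ) : ((X^2 - 1) * derivative (derivative Q)).coeff d =
    (d:ℝ) * ((d:ℝ)-1) * Q.coeff d - ((d:ℝ)+1)*((d:ℝ)+2) * Q.coeff (d+2) := by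
  rw [sub_mul, one_mul, coeff_sub, coeff_X_pow_mul']
  rcases d with _ | _ | d
  · simp [coeff_derivative]; ring
  · simp [coeff_derivative]; ring
  · simp [coeff_derivative]; ring

lemma ode_unique (Q : ℝ[X]) (k : ℕ) (hd : ∀ d, k + 2 ≤ d → Q.coeff d = 0)
    (h : (X^2 - 1) * derivative (derivative Q) = C (((k:ℝ)+2)*((k:ℝ)+1)) * Q) : Q = 0 := by
  by_contra hQ
  set d := Q.natDegree with hdd
  have hlc : Q.coeff d ≠ 0 := by
    rw [hdd, coeff_natDegree]; exact leadingCoeff_ne_zero.mpr hQ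
  have hlt : d < k + 2 := by
    by_contra hh
    exact hlc (hd d (by omega))
  have h1 := congrArg (fun p => coeff p d) h
  simp only [coeff_ode, coeff_C_mul] at h1
  rw [coeff_eq_zero_of_natDegree_lt (show Q.natDegree < d + 2 by omega)] at h1
  have h2 : (d:ℝ) * ((d:ℝ)-1) = ((k:ℝ)+2)*((k:ℝ)+1) := by
    apply mul_right_cancel₀ hlc; linarith
  have h3 : (d:ℝ) ≤ k + 1 := by exact_mod_cast Nat.lt_succ_iff.mp hlt
  have h4 : (0:ℝ) ≤ d := by positivity
  have h5 : (0:ℝ) ≤ k := by positivity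
  nlinarith

lemma ode_eq_fekPoly (F : ℝ[X]) (k : ℕ) (hF : F.Monic) (hd : F.natDegree = k + 2)
    (h : (X^2 - 1) * derivative (derivative F) = C (((k:ℝ)+2)*((k:ℝ)+1)) * F) :
    F = fekPoly k := by
  rw [← sub_eq_zero]
  obtain ⟨g1, g2⟩ := fekPoly_monic k
  apply ode_unique _ k
  · intro d hdk
    rw [coeff_sub]
    rcases hdk.eq_or_lt with e | e
    · rw [← e]
      have a : F.coeff (k+2) = 1 := by rw [← hd]; exact hF
      have b : (fekPoly k).coeff (k+2) = 1 := by rw [← g2]; exact g1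
      rw [a, b, sub_self]
    · rw [coeff_eq_zero_of_natDegree_lt (by omega), coeff_eq_zero_of_natDegree_lt (by omega),
        sub_self]
  · rw [derivative_sub, derivative_sub, mul_sub, h, fekPoly_ode, mul_sub]

lemma abs_res_step (k : ℕ) (c : ℝ) (hc : 0 < c) :
    |resultant (X * monLeg (k+1) - C c * monLeg k) (monLeg (k+1)) (k+2) (k+1)| =
      c^(k+1) * |resultant (monLeg (k+1)) (monLeg k) (k+1) k| := by
  obtain ⟨⟨a1, a2⟩, ⟨b1, b2⟩⟩ := monLeg_monic k
  have e : X * monLeg (k+1) - C c * monLeg k = C (-c) * monLeg k + monLeg (k+1) * X := by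
    rw [C_neg]; ring
  have hl : (monLeg (k+1)).coeff (k+1) = 1 := by
    have := b1.coeff_natDegree; rwa [b2] at this
  rw [e, resultant_add_mul_left _ _ _ _ _ (by rw [natDegree_X]; omega) b2.le,
    resultant_C_mul_left, resultant_add_left_deg (k := 2) _ _ _ _ a2.le, hl, resultant_comm]
  simp [abs_mul, abs_pow, abs_of_pos hc]

lemma abs_res (k : ℕ) : |resultant (monLeg (k+1)) (monLeg k) (k+1) k| =
    ∏ j ∈ Finset.range k, bL j ^ (j+1) := by
  induction k with
  | zero => simp [monLeg]
  | succ k ih =>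
    rw [Finset.prod_range_succ, ← ih, mul_comm, ← abs_res_step _ _ (bL_pos k), ← monLeg_succ]

lemma prod_deriv_nodal (k : ℕ) (x : Fin (k+2) → ℝ)
    (h : Lagrange.nodal Finset.univ x = fekPoly k) :
    ∏ i, |eval (x i) (derivative (Lagrange.nodal Finset.univ x))| =
      ((k:ℝ)+2)^(k+2) * (cL k ^ (k+1) * ∏ j ∈ Finset.range k, bL j ^ (j+1)) := by
  rw [← abs_res, ← abs_res_step _ _ (cL_pos k)]
  change _ = _ * |resultant (fekPoly k) _ _ _|
  have hr : resultant (fekPoly k) (monLeg (k+1)) (k+2) (k+1) = ∏ i, eval (x i) (monLeg (k+1)) := by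
    have := resultant_prod_left Finset.univ (fun i => X - C (x i)) (monLeg (k+1)) (k+1)
      (by simp) (monLeg_monic k).2.2.le
    rw [← Lagrange.nodal_eq, h, (fekPoly_monic k).2] at this
    rw [this]
    refine Finset.prod_congr rfl fun i _ => ?_
    rw [natDegree_X_sub_C, resultant_X_sub_C_left _ _ _ (monLeg_monic k).2.2.le]
  rw [hr, h, fekPoly_deriv, Finset.abs_prod]
  simp only [eval_mul, eval_C, abs_mul, Finset.prod_mul_distrib, Finset.prod_const]
  rw [abs_of_pos (show (0:ℝ) < k + 2 by positivity)]
  simp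

end

lemma log_step (j : ℕ) (hj : 1 ≤ j) :
    (1/4) * (Real.log (j+1) - Real.log j) ≤ -(j:ℝ) * Real.log (1 - 1/(4*(j:ℝ)^2)) ∧
    -(j:ℝ) * Real.log (1 - 1/(4*(j:ℝ)^2)) ≤ (1/4) * (Real.log (j+1) - Real.log j)
      + (1/(j:ℝ) - 1/((j:ℝ)+1)) := by
  have hj' : (1:ℝ) ≤ j := by exact_mod_cast hj
  have hj0 : (0:ℝ) < j := by linarith
  have hu : 1/(4*(j:ℝ)^2) < 1 := by
    rw [div_lt_one (by positivity)]; nlinarith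
  have hlog : Real.log (j+1) - Real.log j = Real.log (1 + 1/(j:ℝ)) := by
    rw [← Real.log_div (by positivity) (by positivity)]; congr 1; field_simp
  have hlog2 : Real.log (j+1) - Real.log j = - Real.log (1 - 1/((j:ℝ)+1)) := by
    rw [← neg_sub, ← Real.log_div (by positivity) (by positivity)]; congr 2; field_simp; ring
  have a1 : Real.log (j+1) - Real.log j ≤ 1/(j:ℝ) := by
    rw [hlog]; have := Real.log_le_sub_one_of_pos (show 0 < 1 + 1/(j:ℝ) by positivity); linarith
  have a2 : 1/((j:ℝ)+1) ≤ Real.log (j+1) - Real.log j := by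
    rw [hlog2]
    have : 0 < 1 - 1/((j:ℝ)+1) := by
      rw [sub_pos, div_lt_one (by positivity)]; linarith
    have := Real.log_le_sub_one_of_pos this; linarith
  have b1 : 1/(4*(j:ℝ)^2) ≤ -Real.log (1 - 1/(4*(j:ℝ)^2)) := by
    have := Real.log_le_sub_one_of_pos (sub_pos.mpr hu); linarith
  have b2 : -Real.log (1 - 1/(4*(j:ℝ)^2)) ≤ 1/(4*(j:ℝ)^2-1) := by
    have h := Real.one_sub_inv_le_log_of_pos (sub_pos.mpr hu)
    have h4 : 0 < 4*(j:ℝ)^2 - 1 := by nlinarith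
    have e : 1 - (1 - 1/(4*(j:ℝ)^2))⁻¹ = -(1/(4*(j:ℝ)^2-1)) := by
      have : 1 - 1/(4*(j:ℝ)^2) = (4*(j:ℝ)^2-1)/(4*(j:ℝ)^2) := by field_simp
      rw [this, inv_div]; field_simp; ring
    linarith
  constructor
  · have : (j:ℝ) * (1/(4*(j:ℝ)^2)) ≤ j * -Real.log (1 - 1/(4*(j:ℝ)^2)) := by gcongr
    have e : (j:ℝ) * (1/(4*(j:ℝ)^2)) = 1/4 * (1/j) := by field_simp
    linarith
  · have : j * -Real.log (1 - 1/(4*(j:ℝ)^2)) ≤ (j:ℝ) * (1/(4*(j:ℝ)^2-1)) := by gcongr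
    have h4 : 0 < 4*(j:ℝ)^2 - 1 := by nlinarith
    have e : (j:ℝ) * (1/(4*(j:ℝ)^2-1)) ≤ 1/4 * (1/((j:ℝ)+1)) + (1/(j:ℝ) - 1/((j:ℝ)+1)) := by
      have : 1/4 * (1/((j:ℝ)+1)) + (1/(j:ℝ) - 1/((j:ℝ)+1)) = ((j:ℝ)+4)/(4*(j*(j+1))) := by
        field_simp; ring
      rw [this, mul_one_div, div_le_div_iff₀ h4 (by positivity)]
      nlinarith [mul_pos hj0 hj0]
    linarith

lemma sum_bounds (k : ℕ) :
    (1/4) * Real.log (k+1) ≤ ∑ j ∈ Finset.range k,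
      (-((j+1:ℕ):ℝ) * Real.log (1 - 1/(4*((j+1:ℕ):ℝ)^2))) ∧
    ∑ j ∈ Finset.range k,
      (-((j+1:ℕ):ℝ) * Real.log (1 - 1/(4*((j+1:ℕ):ℝ)^2))) ≤ (1/4) * Real.log (k+1)
       + (1 - 1/((k:ℝ)+1)) := by
  induction k with
  | zero => simp
  | succ k ih =>
    rw [Finset.sum_range_succ]
    have h := log_step (k+1) (by omega)
    have e : ((k+1:ℕ):ℝ) = (k:ℝ)+1 := by push_cast; ring
    rw [e] at h ⊢
    constructor <;> linarith [h.1, h.2, ih.1, ih.2]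

lemma log_bL (j : ℕ) : ((j:ℝ)+1) * Real.log (bL j) =
    -(2 * Real.log 2) * ((j:ℝ)+1) + (-((j+1:ℕ):ℝ) * Real.log (1 - 1/(4*((j+1:ℕ):ℝ)^2))) := by
  have e : bL j = (2^2 * (1 - 1/(4*((j+1:ℕ):ℝ)^2)))⁻¹ := by
    apply eq_inv_of_mul_eq_one_left
    unfold bL; push_cast; field_simp; ring
  have hu : 0 < 1 - 1/(4*((j+1:ℕ):ℝ)^2) := by
    rw [sub_pos, div_lt_one (by positivity)]; push_cast; nlinarith [Nat.cast_nonneg (α := ℝ) j]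
  rw [e, Real.log_inv, Real.log_mul (by norm_num) hu.ne', Real.log_pow]
  push_cast; ring

lemma log_formula_bound (k : ℕ) :
    |-Real.log (((k:ℝ)+2)^(k+2) * (cL k ^ (k+1) * ∏ j ∈ Finset.range k, bL j ^ (j+1)))
      - Real.log 2 * ((k:ℝ)+2) ^ 2 + ((k:ℝ)+2) * Real.log ((k:ℝ)+2)
        + 2 * Real.log 2 * ((k:ℝ)+2) + (1 / 4) * Real.log ((k:ℝ)+2)| ≤ 10 := by
  have hP : (∏ j ∈ Finset.range k, bL j ^ (j+1)) ≠ 0 :=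
    Finset.prod_ne_zero_iff.mpr fun j _ => (pow_pos (bL_pos j) _).ne'
  have hc := pow_pos (cL_pos k) (k+1)
  rw [Real.log_mul (by positivity) (mul_ne_zero hc.ne' hP), Real.log_mul hc.ne' hP,
    Real.log_prod (fun j _ => (pow_pos (bL_pos j) _).ne')]
  simp only [Real.log_pow]
  have hs : ∑ j ∈ Finset.range k, ((j+1:ℕ):ℝ) * Real.log (bL j) =
      -(2 * Real.log 2) * ((k:ℝ)*(k+1)/2) + ∑ j ∈ Finset.range k,
      (-((j+1:ℕ):ℝ) * Real.log (1 - 1/(4*((j+1:ℕ):ℝ)^2))) := by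
    have : ∑ j ∈ Finset.range k, ((j:ℝ)+1) = (k:ℝ)*(k+1)/2 := by
      clear hP hc
      induction k with
      | zero => simp
      | succ k ih => rw [Finset.sum_range_succ, ih]; push_cast; ring
    rw [← this, Finset.mul_sum, ← Finset.sum_add_distrib]
    refine Finset.sum_congr rfl fun j _ => ?_
    rw [← log_bL]; push_cast; ring
  rw [hs]
  obtain ⟨s1, s2⟩ := sum_bounds k
  set S := ∑ j ∈ Finset.range k,
      (-((j+1:ℕ):ℝ) * Real.log (1 - 1/(4*((j+1:ℕ):ℝ)^2)))
  have hk0 : (0:ℝ) ≤ k := by positivity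
  have c1 : Real.log (cL k) = - Real.log 2 + Real.log (((k:ℝ)+1)/(k+1/2)) := by
    rw [← Real.log_inv, ← Real.log_mul (by norm_num) (by positivity)]
    congr 1; unfold cL; field_simp
  have c2 : 0 ≤ Real.log (((k:ℝ)+1)/(k+1/2)) :=
    Real.log_nonneg (by rw [one_le_div (by positivity)]; linarith)
  have c3 : ((k:ℝ)+1) * Real.log (((k:ℝ)+1)/(k+1/2)) ≤ 1 := by
    have h := Real.log_le_sub_one_of_pos (show 0 < ((k:ℝ)+1)/(k+1/2) by positivity)
    calc _ ≤ ((k:ℝ)+1) * (((k:ℝ)+1)/(k+1/2) - 1) := by gcongr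
      _ ≤ 1 := by
        have : ((k:ℝ)+1) * (((k:ℝ)+1)/(k+1/2) - 1) = ((k:ℝ)+1)/(2*k+1) := by field_simp; ring
        rw [this, div_le_one (by positivity)]; linarith
  have c4 : 0 ≤ ((k:ℝ)+1) * Real.log (((k:ℝ)+1)/(k+1/2)) := by positivity
  have d1 : Real.log ((k:ℝ)+1) ≤ Real.log ((k:ℝ)+2) := Real.log_le_log (by positivity) (by linarith)
  have d2 : Real.log ((k:ℝ)+2) ≤ Real.log ((k:ℝ)+1) + Real.log 2 := by
    rw [← Real.log_mul (by positivity) (by norm_num)]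
    exact Real.log_le_log (by positivity) (by linarith)
  have l0 : 0 < Real.log 2 := Real.log_pos (by norm_num)
  have l1 : Real.log 2 ≤ 1 := by linarith [Real.log_two_lt_d9]
  have hi : 0 ≤ 1/((k:ℝ)+1) := by positivity
  rw [c1]
  push_cast
  rw [abs_le]
  constructor <;> nlinarith

section
open Polynomial

/-- product of all distances over ordered pairs -/
noncomputable def WW {n : ℕ} (x : Fin n → ℝ) : ℝ :=
  ∏ i, ∏ j ∈ Finset.univ.erase i, |x i - x j|

lemma Elog_eq {n : ℕ} (x : Fin n → ℝ) (hx : Function.Injective x) :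
    Elog n x = - Real.log (WW x) := by
  unfold Elog WW
  have hne : ∀ i, ∀ j ∈ Finset.univ.erase i, |x i - x j| ≠ 0 := by
    intro i j hj
    rw [Finset.mem_erase] at hj
    exact abs_ne_zero.mpr (sub_ne_zero.mpr fun h => hj.1 (hx h).symm)
  rw [Real.log_prod (fun i _ => Finset.prod_ne_zero_iff.mpr (hne i))]
  congr 1
  refine Finset.sum_congr rfl fun i _ => ?_
  rw [Real.log_prod (hne i), ← Finset.sum_filter]
  refine Finset.sum_congr ?_ fun _ _ => rfl
  ext j; simp [eq_comm]

lemma WW_pos {n : ℕ} (x : Fin n → ℝ) (hx : Function.Injective x) : 0 < WW x := by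
  unfold WW
  refine Finset.prod_pos fun i _ => Finset.prod_pos fun j hj => ?_
  rw [Finset.mem_erase] at hj
  exact abs_pos.mpr (sub_ne_zero.mpr fun h => hj.1 (hx h).symm)

lemma inj_of_WW_pos {n : ℕ} (x : Fin n → ℝ) (h : 0 < WW x) : Function.Injective x := by
  intro i j hij
  by_contra hne
  have : WW x = 0 := by
    unfold WW
    refine Finset.prod_eq_zero (Finset.mem_univ i) (Finset.prod_eq_zero
      (Finset.mem_erase.mpr ⟨fun h => hne h.symm, Finset.mem_univ j⟩) ?_)
    rw [hij, sub_self, abs_zero]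
  exact h.ne' this

lemma WW_cont (n : ℕ) : Continuous (WW (n := n)) := by
  unfold WW
  fun_prop

lemma exists_max (n : ℕ) : ∃ x : Fin n → ℝ, (∀ i, x i ∈ Set.Icc (-1:ℝ) 1) ∧ 0 < WW x ∧
    ∀ y : Fin n → ℝ, (∀ i, y i ∈ Set.Icc (-1:ℝ) 1) → WW y ≤ WW x := by
  have hK : IsCompact (Set.univ.pi fun _ : Fin n => Set.Icc (-1:ℝ) 1) :=
    isCompact_univ_pi fun _ => isCompact_Icc
  let z : Fin n → ℝ := fun i => (i:ℝ)/n
  have hz : z ∈ (Set.univ.pi fun _ : Fin n => Set.Icc (-1:ℝ) 1) := by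
    intro i _
    have h0 : (0:ℝ) ≤ z i := by positivity
    have hi : ((i:ℕ):ℝ) ≤ n := by exact_mod_cast i.2.le
    have h1 : z i ≤ 1 := div_le_one_of_le₀ hi (by positivity)
    exact ⟨by linarith, h1⟩
  have hzi : Function.Injective z := by
    intro i j hij
    have hn : (n:ℝ) ≠ 0 := by
      have := i.2; exact_mod_cast (by omega : n ≠ 0)
    have : ((i:ℕ):ℝ) = j := by
      have h : (i:ℝ)/n = (j:ℝ)/n := hij
      field_simp at h
      exact h
    exact Fin.ext (by exact_mod_cast this)
  obtain ⟨x, hx, hmax⟩ := hK.exists_isMaxOn ⟨z, hz⟩ (WW_cont n).continuousOn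
  refine ⟨x, fun i => hx i (Set.mem_univ i), lt_of_lt_of_le (WW_pos z hzi) (hmax hz), ?_⟩
  intro y hy
  exact hmax (fun i _ => hy i)

lemma minEnergy_eq {n : ℕ} (x : Fin n → ℝ) (hx : ∀ i, x i ∈ Set.Icc (-1:ℝ) 1) (hp : 0 < WW x)
    (hm : ∀ y : Fin n → ℝ, (∀ i, y i ∈ Set.Icc (-1:ℝ) 1) → WW y ≤ WW x) :
    minEnergy n = - Real.log (WW x) := by
  have : IsLeast {E : ℝ | ∃ x : Fin n → ℝ, (∀ i, x i ∈ Set.Icc (-1 : ℝ) 1) ∧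
    Function.Injective x ∧ E = Elog n x} (- Real.log (WW x)) := by
    constructor
    · exact ⟨x, hx, inj_of_WW_pos x hp, (Elog_eq x (inj_of_WW_pos x hp)).symm⟩
    · rintro E ⟨y, hy, hyi, rfl⟩
      rw [Elog_eq y hyi]
      exact neg_le_neg (Real.log_le_log (WW_pos y hyi) (hm y hy))
  exact this.csInf_eq

lemma WW_split {n : ℕ} (x : Fin n → ℝ) (i : Fin n) :
    WW x = (∏ j ∈ Finset.univ.erase i, |x i - x j|)^2 *
      ∏ k ∈ Finset.univ.erase i, ∏ j ∈ (Finset.univ.erase i).erase k, |x k - x j| := by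
  unfold WW
  rw [← Finset.mul_prod_erase _ _ (Finset.mem_univ i), sq, mul_assoc]
  congr 1
  rw [← Finset.prod_mul_distrib]
  refine Finset.prod_congr rfl fun k hk => ?_
  rw [Finset.mem_erase] at hk
  rw [← Finset.mul_prod_erase (Finset.univ.erase k) (fun j => |x k - x j|)
    (Finset.mem_erase.mpr ⟨hk.1.symm, Finset.mem_univ i⟩), abs_sub_comm, Finset.erase_right_comm]

lemma one_var {n : ℕ} (x : Fin n → ℝ) (hx : ∀ i, x i ∈ Set.Icc (-1:ℝ) 1) (hp : 0 < WW x)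
    (hm : ∀ y : Fin n → ℝ, (∀ i, y i ∈ Set.Icc (-1:ℝ) 1) → WW y ≤ WW x)
    (i : Fin n) (t : ℝ) (ht : t ∈ Set.Icc (-1:ℝ) 1) :
    ∏ j ∈ Finset.univ.erase i, |t - x j| ≤ ∏ j ∈ Finset.univ.erase i, |x i - x j| := by
  have h1 := hm (Function.update x i t) (by
    intro j
    by_cases h : j = i
    · subst h; simpa using ht
    · simpa [h] using hx j)
  rw [WW_split _ i, WW_split x i] at h1
  have e1 : ∏ j ∈ Finset.univ.erase i, |Function.update x i t i - Function.update x i t j| =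
      ∏ j ∈ Finset.univ.erase i, |t - x j| := by
    refine Finset.prod_congr rfl fun j hj => ?_
    rw [Function.update_self, Function.update_of_ne (Finset.ne_of_mem_erase hj)]
  have e2 : ∏ k ∈ Finset.univ.erase i, ∏ j ∈ (Finset.univ.erase i).erase k,
      |Function.update x i t k - Function.update x i t j| =
      ∏ k ∈ Finset.univ.erase i, ∏ j ∈ (Finset.univ.erase i).erase k, |x k - x j| := by
    refine Finset.prod_congr rfl fun k hk => Finset.prod_congr rfl fun j hj => ?_
    rw [Function.update_of_ne (Finset.ne_of_mem_erase hk),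
      Function.update_of_ne (Finset.ne_of_mem_erase (Finset.mem_of_mem_erase hj))]
  rw [e1, e2] at h1
  have hR : 0 < ∏ k ∈ Finset.univ.erase i, ∏ j ∈ (Finset.univ.erase i).erase k, |x k - x j| := by
    rw [WW_split x i] at hp
    exact pos_of_mul_pos_right hp (by positivity)
  have h2 := le_of_mul_le_mul_right h1 hR
  exact le_of_sq_le_sq h2 (Finset.prod_nonneg fun _ _ => abs_nonneg _)

lemma crit {n : ℕ} (x : Fin n → ℝ) (hx : ∀ i, x i ∈ Set.Icc (-1:ℝ) 1) (hp : 0 < WW x)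
    (hm : ∀ y : Fin n → ℝ, (∀ i, y i ∈ Set.Icc (-1:ℝ) 1) → WW y ≤ WW x)
    (i : Fin n) (hi : x i ∈ Set.Ioo (-1:ℝ) 1) :
    eval (x i) (derivative (derivative (Lagrange.nodal Finset.univ x))) = 0 := by
  rw [Lagrange.nodal_eq_mul_nodal_erase (Finset.mem_univ i)]
  set H := Lagrange.nodal (Finset.univ.erase i) x with hH
  have hxi := inj_of_WW_pos x hp
  have hH0 : eval (x i) H ≠ 0 := Lagrange.eval_nodal_not_at_node
    fun j hj h => (Finset.ne_of_mem_erase hj) (hxi h).symm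
  have hloc : IsLocalMax (fun t => eval t (H^2)) (x i) := by
    filter_upwards [Ioo_mem_nhds hi.1 hi.2] with t ht
    have := one_var x hx hp hm i t ⟨ht.1.le, ht.2.le⟩
    rw [← Finset.abs_prod, ← Finset.abs_prod, ← Lagrange.eval_nodal, ← Lagrange.eval_nodal] at this
    simp only [eval_pow]
    exact sq_le_sq.mpr this
  have hd := hloc.deriv_eq_zero
  rw [Polynomial.deriv, derivative_pow] at hd
  have h0 : eval (x i) (derivative H) = 0 := by
    simpa [hH0] using hd
  simp [h0]

lemma nodal_ode {n : ℕ} (x : Fin n → ℝ) (hx : ∀ i, x i ∈ Set.Icc (-1:ℝ) 1) (hp : 0 < WW x)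
    (hm : ∀ y : Fin n → ℝ, (∀ i, y i ∈ Set.Icc (-1:ℝ) 1) → WW y ≤ WW x)
    :
    (X^2 - 1) * derivative (derivative (Lagrange.nodal Finset.univ x)) =
      C ((n:ℝ)*((n:ℝ)-1)) * Lagrange.nodal Finset.univ x := by
  set F := Lagrange.nodal Finset.univ x with hF
  have hdeg : F.natDegree = n := by simp [hF]
  rw [← sub_eq_zero]
  have hxi := inj_of_WW_pos x hp
  apply Polynomial.eq_zero_of_degree_lt_of_eval_index_eq_zero (v := x) (s := Finset.univ) hxi.injOn
  · rw [Polynomial.degree_lt_iff_coeff_zero]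
    intro d hd
    rw [Finset.card_univ, Fintype.card_fin] at hd
    rw [coeff_sub, coeff_ode, coeff_C_mul,
      coeff_eq_zero_of_natDegree_lt (show F.natDegree < d + 2 by omega)]
    rcases hd.eq_or_lt with e | e
    · subst e; ring
    · rw [coeff_eq_zero_of_natDegree_lt (show F.natDegree < d by omega)]; ring
  · intro i _
    rw [eval_sub, eval_mul, eval_mul, hF, Lagrange.eval_nodal_at_node (Finset.mem_univ i)]
    by_cases hi : x i ∈ Set.Ioo (-1:ℝ) 1
    · rw [crit x hx hp hm i hi]; simp
    · have : x i = 1 ∨ x i = -1 := by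
        by_contra hh
        push Not at hh
        exact hi ⟨lt_of_le_of_ne (hx i).1 hh.2.symm, lt_of_le_of_ne (hx i).2 hh.1⟩
      rcases this with h | h <;> simp [h]

end

theorem min_log_energy_interval_asymptotics :
    ∃ C > (0 : ℝ), ∃ N : ℕ, ∀ n : ℕ, N ≤ n →
      |minEnergy n - Real.log 2 * (n : ℝ) ^ 2 + (n : ℝ) * Real.log n
        + 2 * Real.log 2 * (n : ℝ) + (1 / 4) * Real.log n| ≤ C := by
  refine ⟨10, by norm_num, 2, ?_⟩
  intro n hn
  obtain ⟨k, rfl⟩ : ∃ k, n = k + 2 := ⟨n - 2, by omega⟩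
  obtain ⟨x, hx, hp, hm⟩ := exists_max (k+2)
  have hode := nodal_ode x hx hp hm
  have hF : Lagrange.nodal Finset.univ x = fekPoly k := by
    apply ode_eq_fekPoly _ k Lagrange.nodal_monic (by simp)
    rw [hode]
    congr 2
    push_cast; ring
  have hW : WW x = ((k:ℝ)+2)^(k+2) * (cL k ^ (k+1) * ∏ j ∈ Finset.range k, bL j ^ (j+1)) := by
    have := prod_deriv_nodal k x hF
    rw [← this]
    unfold WW
    refine Finset.prod_congr rfl fun i _ => ?_
    rw [Lagrange.eval_nodal_derivative_eval_node_eq (Finset.mem_univ i), Lagrange.eval_nodal,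
      Finset.abs_prod]
  rw [minEnergy_eq x hx hp hm, hW]
  have := log_formula_bound k
  push_cast
  exact this
end

section
/- Let f : [-1,1]² → ℝ be a continuous function. Then ∬_{[-1,1]²} f(x,y) / ( √(1-x²)·√(1-y²) ) · log( 1/(2|x-y|) ) dx dy = (1/2) · ∫_{-π}^{π} log( 1/√(2-2·cos α) ) · ( ∫_{-π}^{π} f( cos θ, cos(θ+α) ) dθ ) dα. -/
open Real MeasureTheory

noncomputable def LL (α : ℝ) : ℝ := Real.log (1 / Real.sqrt (2 - 2 * Real.cos α))

lemma LL_neg (α : ℝ) : LL (-α) = LL α := by simp [LL]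

lemma LL_per (α : ℝ) : LL (α + 2 * π) = LL α := by simp [LL]

lemma LL_int (a b : ℝ) : IntervalIntegrable LL volume a b := by
  have h : LL = fun α => -(1/2) * Real.log (2 - 2 * Real.cos α) := by
    funext α
    have : 0 ≤ 2 - 2 * Real.cos α := by linarith [Real.cos_le_one α]
    rw [LL, one_div, Real.log_inv, Real.log_sqrt this]; ring
  rw [h]
  apply IntervalIntegrable.const_mul
  apply MeromorphicOn.intervalIntegrable_log
  intro x _
  apply AnalyticAt.meromorphicAt
  fun_prop

lemma LL_add (s t : ℝ) (h : Real.cos s ≠ Real.cos t) :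
    Real.log (1 / (2 * |Real.cos s - Real.cos t|)) = LL (t - s) + LL (t + s) := by
  have e : (2 * |Real.cos s - Real.cos t|)^2
      = (2 - 2 * Real.cos (t - s)) * (2 - 2 * Real.cos (t + s)) := by
    rw [mul_pow, sq_abs, Real.cos_sub, Real.cos_add]
    have h1 := Real.sin_sq_add_cos_sq s
    have h2 := Real.sin_sq_add_cos_sq t
    have : Real.sin t ^2 * Real.sin s ^2 = (1 - Real.cos t^2) * (1 - Real.cos s ^2) := by
      rw [Real.sin_sq, Real.sin_sq]
    linear_combination 4 * this
  have p1 : 0 ≤ 2 - 2 * Real.cos (t - s) := by linarith [Real.cos_le_one (t - s)]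
  have p2 : 0 ≤ 2 - 2 * Real.cos (t + s) := by linarith [Real.cos_le_one (t + s)]
  have p3 : 0 < 2 * |Real.cos s - Real.cos t| := by
    have := abs_pos.2 (sub_ne_zero.2 h); positivity
  have p4 : (2 - 2 * Real.cos (t - s)) * (2 - 2 * Real.cos (t + s)) ≠ 0 := by
    rw [← e]; positivity
  have n1 := left_ne_zero_of_mul p4
  have n2 := right_ne_zero_of_mul p4
  have := congrArg Real.log e
  rw [Real.log_mul n1 n2, Real.log_pow] at this
  simp only [LL, one_div, Real.log_inv, Real.log_sqrt p1, Real.log_sqrt p2]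
  push_cast at this
  linarith

lemma cov (g h : ℝ → ℝ) (H : ∀ s ∈ Set.Ioo 0 π, Real.sin s * g (Real.cos s) = h s) :
    ∫ x in Set.Icc (-1 : ℝ) 1, g x = ∫ s in (0:ℝ)..π, h s := by
  have im : Real.cos '' Set.Ioo 0 π = Set.Ioo (-1) 1 := by
    ext x; constructor
    · rintro ⟨s, hs, rfl⟩
      constructor
      · have := Real.cos_lt_cos_of_nonneg_of_le_pi hs.1.le le_rfl hs.2
        simpa using this
      · have := Real.cos_lt_cos_of_nonneg_of_le_pi le_rfl hs.2.le hs.1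
        simpa using this
    · intro hx
      exact ⟨Real.arccos x, ⟨Real.arccos_pos.2 hx.2,
        lt_of_le_of_ne (Real.arccos_le_pi x) (fun h => by
          have := Real.arccos_eq_pi.1 h; linarith [hx.1])⟩,
        Real.cos_arccos hx.1.le hx.2.le⟩
  rw [integral_Icc_eq_integral_Ioo, ← im,
    integral_image_eq_integral_abs_deriv_smul measurableSet_Ioo
      (fun x _ => (Real.hasDerivAt_cos x).hasDerivWithinAt)
      (Real.injOn_cos.mono Set.Ioo_subset_Icc_self),
    intervalIntegral.integral_of_le pi_pos.le, integral_Ioc_eq_integral_Ioo]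
  apply setIntegral_congr_fun measurableSet_Ioo
  intro s hs
  have := Real.sin_pos_of_pos_of_lt_pi hs.1 hs.2
  simp only [abs_neg, abs_of_pos this, smul_eq_mul]
  exact H s hs

lemma even_half (H : ℝ → ℝ) (he : ∀ s, H (-s) = H s)
    (hi : IntervalIntegrable H volume (-π) π) :
    ∫ s in (0:ℝ)..π, H s = (1/2) * ∫ s in (-π)..π, H s := by
  have a := hi.mono_set (c := -π) (d := 0) (by
    rw [Set.uIcc_of_le (by linarith [pi_pos]), Set.uIcc_of_le (by linarith [pi_pos])]
    exact Set.Icc_subset_Icc_right pi_pos.le)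
  have b := hi.mono_set (c := 0) (d := π) (by
    rw [Set.uIcc_of_le (by linarith [pi_pos]), Set.uIcc_of_le (by linarith [pi_pos])]
    exact Set.Icc_subset_Icc_left (by linarith [pi_pos]))
  rw [← intervalIntegral.integral_add_adjacent_intervals a b]
  have := intervalIntegral.integral_comp_neg (a := 0) (b := π) H
  simp only [he, neg_zero] at this
  rw [← this]; ring

/-- the inner integral -/
lemma inner_eq (G : ℝ → ℝ → ℝ) (hG : Continuous (fun p : ℝ × ℝ => G p.1 p.2))
    (ev : ∀ s t, G s (-t) = G s t) (per : ∀ s t, G s (t + 2 * π) = G s t)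
    (s : ℝ) (hs : s ∈ Set.Ioo 0 π) :
    ∫ t in (0:ℝ)..π, G s t * Real.log (1 / (2 * |Real.cos s - Real.cos t|))
      = ∫ α in (-π)..π, LL α * G s (s + α) := by
  have hGs : Continuous (G s) := hG.comp (by fun_prop : Continuous fun t => (s, t))
  have i1 : ∀ c a b, IntervalIntegrable (fun t => G s t * LL (t + c)) volume a b := by
    intro c a b
    apply IntervalIntegrable.continuousOn_mul _ hGs.continuousOn
    have := (LL_int (a + c) (b + c)).comp_add_right c
    simpa using this
  have e1 : ∫ t in (0:ℝ)..π, G s t * Real.log (1 / (2 * |Real.cos s - Real.cos t|))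
      = ∫ t in (0:ℝ)..π, (G s t * LL (t + -s) + G s t * LL (t + s)) := by
    apply intervalIntegral.integral_congr_ae
    have : ∀ᵐ t : ℝ, t ≠ s := by simp [ae_iff]
    filter_upwards [this] with t ht hm
    rw [Set.uIoc_of_le pi_pos.le] at hm
    rw [LL_add s t, sub_eq_add_neg]; ring
    intro h
    exact ht (Real.injOn_cos ⟨hs.1.le, hs.2.le⟩ ⟨hm.1.le, hm.2⟩ h).symm
  rw [e1, intervalIntegral.integral_add (i1 _ _ _) (i1 _ _ _)]
  have e2 := intervalIntegral.integral_comp_neg (a := 0) (b := π) (fun t => G s t * LL (t + -s))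
  have e3 : ∀ t, LL (-t + -s) = LL (t + s) := fun t => by rw [← LL_neg]; congr 1; ring
  simp only [ev, e3, neg_zero] at e2
  rw [e2, add_comm, intervalIntegral.integral_add_adjacent_intervals (i1 _ _ _) (i1 _ _ _)]
  have P : Function.Periodic (fun t => G s t * LL (t + -s)) (2 * π) := by
    intro t
    simp only [per]
    rw [show t + 2 * π + -s = t + -s + 2 * π by ring, LL_per]
  have e4 := P.intervalIntegral_add_eq (-π) (-π + s)
  rw [show -π + 2 * π = π by ring, show -π + s + 2 * π = π + s by ring] at e4
  rw [e4, ← intervalIntegral.integral_comp_add_right]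
  apply intervalIntegral.integral_congr
  intro α _
  simp only
  rw [show α + s + -s = α by ring, add_comm α s, mul_comm]

theorem log_integral_change_of_variables
    (f : ℝ → ℝ → ℝ)
    (hf : ContinuousOn (fun p : ℝ × ℝ => f p.1 p.2)
      (Set.Icc (-1 : ℝ) 1 ×ˢ Set.Icc (-1 : ℝ) 1)) :
    (∫ x in Set.Icc (-1 : ℝ) 1, ∫ y in Set.Icc (-1 : ℝ) 1,
        f x y / (Real.sqrt (1 - x ^ 2) * Real.sqrt (1 - y ^ 2))
          * Real.log (1 / (2 * |x - y|))) =
      (1 / 2) * ∫ α in Set.Icc (-Real.pi) Real.pi,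
        Real.log (1 / Real.sqrt (2 - 2 * Real.cos α)) *
          ∫ θ in Set.Icc (-Real.pi) Real.pi, f (Real.cos θ) (Real.cos (θ + α)) := by
  have hG : Continuous (fun p : ℝ × ℝ => f (Real.cos p.1) (Real.cos p.2)) :=
    hf.comp_continuous (f := fun p : ℝ × ℝ => (Real.cos p.1, Real.cos p.2)) (by fun_prop)
      (fun p => ⟨Real.cos_mem_Icc _, Real.cos_mem_Icc _⟩)
  have hsin : ∀ s ∈ Set.Ioo 0 π, Real.sqrt (1 - Real.cos s ^ 2) = Real.sin s := by
    intro s hs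
    rw [← Real.sin_sq, Real.sqrt_sq (Real.sin_pos_of_pos_of_lt_pi hs.1 hs.2).le]
  let H : ℝ → ℝ := fun s => ∫ α in (-π)..π, LL α * f (Real.cos s) (Real.cos (s + α))
  have step1 : (∫ x in Set.Icc (-1 : ℝ) 1, ∫ y in Set.Icc (-1 : ℝ) 1,
        f x y / (Real.sqrt (1 - x ^ 2) * Real.sqrt (1 - y ^ 2))
          * Real.log (1 / (2 * |x - y|))) = ∫ s in (0:ℝ)..π, H s := by
    apply cov
    intro s hs
    have ps := (Real.sin_pos_of_pos_of_lt_pi hs.1 hs.2).ne'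
    have := inner_eq (fun s t => f (Real.cos s) (Real.cos t)) hG (by simp) (by simp) s hs
    simp only [H]
    rw [← this, ← integral_const_mul]
    apply cov
    intro t ht
    have pt := (Real.sin_pos_of_pos_of_lt_pi ht.1 ht.2).ne'
    rw [hsin s hs, hsin t ht]
    field_simp
  have hint : Integrable (fun p : ℝ × ℝ => LL p.2 * f (Real.cos p.1) (Real.cos (p.1 + p.2)))
      ((volume.restrict (Set.Ioc (-π) π)).prod (volume.restrict (Set.Ioc (-π) π))) := by
    have hL : Integrable LL (volume.restrict (Set.Ioc (-π) π)) :=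
      (intervalIntegrable_iff_integrableOn_Ioc_of_le (by linarith [pi_pos])).1 (LL_int (-π) π)
    have hL2 := hL.comp_snd (volume.restrict (Set.Ioc (-π) π))
    obtain ⟨C, hC⟩ := (isCompact_Icc.prod isCompact_Icc).exists_bound_of_continuousOn hf
    refine hL2.mul_bdd (c := C) ?_ ?_
    · have : Continuous (fun p : ℝ × ℝ => f (Real.cos p.1) (Real.cos (p.1 + p.2))) :=
        hG.comp (g := fun p : ℝ × ℝ => f (Real.cos p.1) (Real.cos p.2))
          (f := fun p : ℝ × ℝ => (p.1, p.1 + p.2)) (by fun_prop)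
      exact this.aestronglyMeasurable
    · exact Filter.Eventually.of_forall fun p =>
        hC (Real.cos p.1, Real.cos (p.1 + p.2)) ⟨Real.cos_mem_Icc _, Real.cos_mem_Icc _⟩
  have hle : -π ≤ π := by linarith [pi_pos]
  have hH : IntervalIntegrable H volume (-π) π := by
    rw [intervalIntegrable_iff_integrableOn_Ioc_of_le hle]
    simp only [H, intervalIntegral.integral_of_le hle]
    exact hint.integral_prod_left
  have hev : ∀ s, H (-s) = H s := by
    intro s
    have := intervalIntegral.integral_comp_neg (a := -π) (b := π)
      (fun α => LL α * f (Real.cos s) (Real.cos (-s + α)))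
    simp only [neg_neg] at this
    simp only [H, Real.cos_neg]
    rw [← this]
    apply intervalIntegral.integral_congr
    intro α _
    simp only
    rw [LL_neg, ← neg_add, Real.cos_neg]
  rw [step1, even_half H hev hH]
  congr 1
  simp only [H, intervalIntegral.integral_of_le hle, integral_Icc_eq_integral_Ioc]
  rw [integral_integral_swap hint]
  simp only [integral_const_mul]
  rfl
end

section
/- Let Si(z) = ∫_0^z (sin t)/t dt be the sine integral function and γ the Euler–Mascheroni constant. Then ∫_0^x Si(t)/t dt - (π/2)·log x - γπ/2 = O(x^{-1}) as x → +∞; that is, there exist constants C > 0 and X > 0 such that | ∫_0^x Si(t)/t dt - (π/2)·log x - γπ/2 | ≤ C/x for all x ≥ X. -/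
open Real intervalIntegral

/-- The sine integral function `Si(z) = ∫_0^z (sin t)/t dt`. -/
noncomputable def Si (z : ℝ) : ℝ := ∫ t in (0 : ℝ)..z, Real.sin t / t

open MeasureTheory Filter Topology Set

lemma Si_eq_sinc (z : ℝ) : Si z = ∫ t in (0 : ℝ)..z, Real.sinc t := by
  unfold Si
  apply intervalIntegral.integral_congr_ae
  have : ∀ᵐ t : ℝ ∂volume, t ≠ 0 := by
    simp [ae_iff, measure_singleton]
  filter_upwards [this] with t ht _
  rw [Real.sinc_of_ne_zero ht]

lemma Si_hasDerivAt (x : ℝ) : HasDerivAt Si (Real.sinc x) x := by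
  have : Si = fun z => ∫ t in (0 : ℝ)..z, Real.sinc t := funext Si_eq_sinc
  rw [this]
  exact Real.continuous_sinc.integral_hasStrictDerivAt 0 x |>.hasDerivAt

lemma Si_continuous : Continuous Si :=
  continuous_iff_continuousAt.2 fun x => (Si_hasDerivAt x).continuousAt

lemma Si_abs_le (z : ℝ) : |Si z| ≤ |z| := by
  rw [Si_eq_sinc]
  have := intervalIntegral.norm_integral_le_of_norm_le_const (a := 0) (b := z) (f := Real.sinc)
    (C := 1) (fun x _ => Real.abs_sinc_le_one x)
  simpa using this

lemma Si_div_abs_le (t : ℝ) : |Si t / t| ≤ 1 := by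
  rw [abs_div]
  exact div_le_one_of_le₀ (Si_abs_le t) (abs_nonneg t)

lemma Si_div_meas : Measurable (fun t => Si t / t) :=
  Si_continuous.measurable.div measurable_id

lemma Si_div_intInt (a b : ℝ) : IntervalIntegrable (fun t => Si t / t) volume a b := by
  refine (intervalIntegrable_const (c := (1:ℝ))).mono_fun Si_div_meas.aestronglyMeasurable ?_
  filter_upwards with t
  rw [norm_eq_abs, norm_one]
  exact Si_div_abs_le t

noncomputable def FF (x : ℝ) : ℝ := ∫ t in (0 : ℝ)..x, Si t / t

lemma FF_abs_le (x : ℝ) : |FF x| ≤ |x| := by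
  have := intervalIntegral.norm_integral_le_of_norm_le_const (a := 0) (b := x)
    (f := fun t => Si t / t) (C := 1) (fun x _ => Si_div_abs_le x)
  simpa [FF] using this

lemma FF_hasDerivAt {x : ℝ} (hx : x ≠ 0) : HasDerivAt FF (Si x / x) x :=
  intervalIntegral.integral_hasDerivAt_right (Si_div_intInt 0 x)
    (Si_div_meas.stronglyMeasurable.stronglyMeasurableAtFilter)
    (Si_continuous.continuousAt.div continuousAt_id hx)

lemma FF_continuous : Continuous FF :=
  intervalIntegral.continuous_primitive (fun a b => Si_div_intInt a b) 0

lemma exists_lim (f f' : ℝ → ℝ) (K : ℝ) (hf : ∀ x, 1 ≤ x → HasDerivAt f (f' x) x)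
    (hK : ∀ x, 1 ≤ x → |f' x| ≤ K / x ^ 2) : ∃ l, ∀ x, 1 ≤ x → |f x - l| ≤ K / x := by
  have hder : ∀ x, 1 ≤ x → HasDerivAt (fun x : ℝ => K / x) (-K / x ^ 2) x := by
    intro x hx
    have hx0 : x ≠ 0 := by linarith
    have := (hasDerivAt_inv hx0).const_mul K
    simpa [div_eq_mul_inv] using this
  have hK0 : 0 ≤ K := by
    have := (abs_nonneg _).trans (hK 1 le_rfl)
    simpa using this
  have ha : MonotoneOn (fun x => f x - K / x) (Ici 1) := by
    have hd : ∀ x, 1 ≤ x → HasDerivAt (fun x => f x - K / x) (f' x - -K / x ^ 2) x :=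
      fun x hx => (hf x hx).sub (hder x hx)
    apply monotoneOn_of_deriv_nonneg (convex_Ici 1)
    · exact fun x hx => (hd x hx).continuousAt.continuousWithinAt
    · intro x hx
      rw [interior_Ici] at hx
      exact (hd x (le_of_lt hx)).differentiableAt.differentiableWithinAt
    · intro x hx
      rw [interior_Ici] at hx
      rw [(hd x (le_of_lt hx)).deriv, neg_div]
      have := neg_le_of_abs_le (hK x (le_of_lt hx))
      linarith
  have hb : AntitoneOn (fun x => f x + K / x) (Ici 1) := by
    have hd : ∀ x, 1 ≤ x → HasDerivAt (fun x => f x + K / x) (f' x + -K / x ^ 2) x :=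
      fun x hx => (hf x hx).add (hder x hx)
    apply antitoneOn_of_deriv_nonpos (convex_Ici 1)
    · exact fun x hx => (hd x hx).continuousAt.continuousWithinAt
    · intro x hx
      rw [interior_Ici] at hx
      exact (hd x (le_of_lt hx)).differentiableAt.differentiableWithinAt
    · intro x hx
      rw [interior_Ici] at hx
      rw [(hd x (le_of_lt hx)).deriv, neg_div]
      have := le_of_abs_le (hK x (le_of_lt hx))
      linarith
  have hab : ∀ x, 1 ≤ x → ∀ y, 1 ≤ y → f x - K / x ≤ f y + K / y := by
    intro x hx y hy
    have hm : 1 ≤ max x y := hx.trans (le_max_left _ _)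
    have h1 := ha hx hm (le_max_left x y)
    have h2 := hb hy hm (le_max_right x y)
    have h3 : 0 ≤ K / max x y := by positivity
    simp only at h1 h2
    linarith
  refine ⟨sSup ((fun x => f x - K / x) '' Ici 1), fun x hx => ?_⟩
  have h1 : f x - K / x ≤ sSup ((fun x => f x - K / x) '' Ici 1) := by
    apply le_csSup
    · exact ⟨f 1 + K / 1, by rintro _ ⟨y, hy, rfl⟩; exact hab y hy 1 le_rfl⟩
    · exact ⟨x, hx, rfl⟩
  have h2 : sSup ((fun x => f x - K / x) '' Ici 1) ≤ f x + K / x := by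
    apply csSup_le
    · exact ⟨_, 1, self_mem_Ici, rfl⟩
    · rintro _ ⟨y, hy, rfl⟩; exact hab y hy x hx
  rw [abs_le]; constructor <;> linarith

lemma exists_L : ∃ L, ∀ x, 1 ≤ x → |Si x - L| ≤ 2 / x := by
  obtain ⟨l, hl⟩ := exists_lim (fun x => Si x + cos x / x) (fun x => - cos x / x ^ 2) 1
    (by
      intro x hx
      have hx0 : x ≠ 0 := by linarith
      have := (Si_hasDerivAt x).add ((Real.hasDerivAt_cos x).div (hasDerivAt_id x) hx0)
      refine this.congr_deriv ?_
      rw [Real.sinc_of_ne_zero hx0]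
      simp only [id]
      field_simp
      ring)
    (by
      intro x hx
      rw [abs_div, abs_neg, abs_of_pos (by positivity : (0:ℝ) < x ^ 2)]
      gcongr
      exact abs_cos_le_one x)
  refine ⟨l, fun x hx => ?_⟩
  have h1 := hl x hx
  have h2 : |cos x / x| ≤ 1 / x := by
    rw [abs_div, abs_of_pos (by linarith : (0:ℝ) < x)]
    gcongr
    exact abs_cos_le_one x
  have e : Si x - l = (Si x + cos x / x - l) - cos x / x := by ring
  rw [e]
  refine (abs_sub _ _).trans ?_
  have : 2 / x = 1 / x + 1 / x := by ring
  linarith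

lemma exists_c : ∃ L c, ∀ x, 1 ≤ x → |FF x - L * log x - c| ≤ 2 / x := by
  obtain ⟨L, hL⟩ := exists_L
  obtain ⟨c, hc⟩ := exists_lim (fun x => FF x - L * log x) (fun x => (Si x - L) / x) 2
    (by
      intro x hx
      have hx0 : x ≠ 0 := by linarith
      refine ((FF_hasDerivAt hx0).sub ((Real.hasDerivAt_log hx0).const_mul L)).congr_deriv ?_
      field_simp)
    (by
      intro x hx
      rw [abs_div, abs_of_pos (by linarith : (0:ℝ) < x), pow_two, ← div_div]
      gcongr
      exact hL x hx)
  exact ⟨L, c, hc⟩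

lemma D_bound (L c : ℝ) (h : ∀ x, 1 ≤ x → |FF x - L * log x - c| ≤ 2 / x) :
    ∃ M, 0 ≤ M ∧ ∀ x, 0 < x → |FF x - L * log x - c| ≤ M * x ^ (-(1/2) : ℝ) := by
  refine ⟨2 + (1 + 2 * |L| + |c|), by positivity, fun x hx => ?_⟩
  have hp : 0 < x ^ (-(1/2) : ℝ) := rpow_pos_of_pos hx _
  rcases le_total 1 x with h1 | h1
  · refine (h x h1).trans ?_
    have : x⁻¹ ≤ x ^ (-(1/2) : ℝ) := by
      rw [← rpow_neg_one]
      exact rpow_le_rpow_of_exponent_le h1 (by norm_num)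
    rw [div_eq_mul_inv, add_mul]
    have : 0 ≤ (1 + 2 * |L| + |c|) * x ^ (-(1/2) : ℝ) := by positivity
    linarith
  · have hlog : |log x| ≤ 2 * x ^ (-(1/2) : ℝ) := by
      have := (abs_log_mul_self_rpow_lt x (1/2) hx h1 (by norm_num)).le
      rw [abs_mul, abs_of_pos (rpow_pos_of_pos hx _), ← le_div_iff₀ (rpow_pos_of_pos hx _)] at this
      rw [rpow_neg hx.le, ← div_eq_mul_inv]
      simpa using this
    have hone : 1 ≤ x ^ (-(1/2) : ℝ) := one_le_rpow_of_pos_of_le_one_of_nonpos hx h1 (by norm_num)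
    have hF := FF_abs_le x
    rw [abs_of_pos hx] at hF
    have t1 : |FF x - L * log x - c| ≤ |FF x| + |L * log x| + |c| :=
      (abs_sub _ _).trans (by gcongr; exact abs_sub _ _)
    rw [abs_mul] at t1
    have t2 : |L| * |log x| ≤ |L| * (2 * x ^ (-(1/2) : ℝ)) := by gcongr
    have t3 : |c| * 1 ≤ |c| * x ^ (-(1/2) : ℝ) := by gcongr
    nlinarith

lemma integrable_log_exp : IntegrableOn (fun t => exp (-t) * log t) (Ioi 0) := by
  have h1 := (Real.GammaIntegral_convergent (s := 1/2) (by norm_num)).const_mul 2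
  have h2 := Real.GammaIntegral_convergent (s := 2) (by norm_num)
  refine (Integrable.add h1 h2).mono' (by fun_prop) ?_
  filter_upwards [self_mem_ae_restrict measurableSet_Ioi] with t (ht : 0 < t)
  have hlog : |log t| ≤ 2 * t ^ (1/2 - 1 : ℝ) + t ^ (2 - 1 : ℝ) := by
    rcases le_total 1 t with h | h
    · rw [abs_of_nonneg (log_nonneg h)]
      have := log_le_sub_one_of_pos ht
      have : 0 ≤ t ^ (1/2 - 1 : ℝ) := by positivity
      norm_num at *
      linarith
    · have := (abs_log_mul_self_rpow_lt t (1/2) ht h (by norm_num)).le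
      rw [abs_mul, abs_of_pos (rpow_pos_of_pos ht _), ← le_div_iff₀ (rpow_pos_of_pos ht _)] at this
      rw [show (1/2 - 1 : ℝ) = -(1/2) by norm_num, rpow_neg ht.le, ← div_eq_mul_inv]
      have : 0 ≤ t ^ (2 - 1 : ℝ) := by positivity
      norm_num at *
      linarith
  simp only [norm_mul, norm_eq_abs, abs_exp, Pi.add_apply]
  calc _ ≤ exp (-t) * (2 * t ^ (1/2 - 1 : ℝ) + t ^ (2 - 1 : ℝ)) := by gcongr
    _ = _ := by ring

lemma integral_log_exp : ∫ t in Ioi (0:ℝ), exp (-t) * log t = - eulerMascheroniConstant := by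
  have h1 := Complex.hasDerivAt_GammaIntegral (s := 1) (by simp)
  have h2 : HasDerivAt Complex.GammaIntegral (-(eulerMascheroniConstant : ℂ)) 1 := by
    refine Complex.hasDerivAt_Gamma_one.congr_of_eventuallyEq ?_
    have : IsOpen {s : ℂ | 0 < s.re} := Complex.continuous_re.isOpen_preimage _ isOpen_Ioi
    filter_upwards [this.mem_nhds (by simp : (0:ℝ) < (1:ℂ).re)] with a ha
    exact (Complex.Gamma_eq_integral ha).symm
  have h3 := h1.unique h2
  simp only [sub_self, Complex.cpow_zero, one_mul] at h3
  have h4 : ∫ t in Ioi (0:ℝ), ((log t : ℂ) * (exp (-t) : ℂ))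
      = ((∫ t in Ioi (0:ℝ), exp (-t) * log t : ℝ) : ℂ) := by
    rw [← integral_complex_ofReal]
    congr 1; ext t; push_cast; ring
  rw [← Complex.ofReal_inj]
  push_cast at h3 h4 ⊢
  rw [← h3, h4]

lemma xsinc_log_intInt (x : ℝ) :
    IntervalIntegrable (fun u => x * sinc (x * u) * (-log u)) volume 0 1 := by
  have h : IntervalIntegrable (fun u => -log u) volume 0 1 := intervalIntegrable_log'.neg
  exact h.continuousOn_mul
    ((continuous_const.mul (continuous_sinc.comp (continuous_const.mul continuous_id))).continuousOn)

lemma FF_eq {x : ℝ} (hx : 0 < x) : FF x = ∫ u in (0:ℝ)..1, x * sinc (x * u) * (-log u) := by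
  have hI : IntervalIntegrable (fun u => x * (Si (x * u) / (x * u))) volume 0 1 := by
    have := ((Si_div_intInt 0 x).comp_mul_left (c := x)).const_mul x
    simpa [hx.ne'] using this
  have h0 : ∫ u in (0:ℝ)..1, x * (Si (x * u) / (x * u)) = FF x := by
    rw [intervalIntegral.integral_const_mul,
      intervalIntegral.integral_comp_mul_left (fun t => Si t / t) hx.ne']
    simp only [mul_zero, mul_one, smul_eq_mul, FF]
    field_simp
  have h1 := intervalIntegral.integral_eq_sub_of_hasDerivAt_of_tendsto (a := 0) (b := 1)
    (f := fun u => Si (x * u) * (-log u))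
    (f' := fun u => x * sinc (x * u) * (-log u) - x * (Si (x * u) / (x * u)))
    (fa := 0) (fb := 0) one_pos
    (by
      intro u hu
      have hu0 : u ≠ 0 := hu.1.ne'
      have a1 : HasDerivAt (fun u => Si (x * u)) (sinc (x * u) * (x * 1)) u :=
        (Si_hasDerivAt (x * u)).comp u ((hasDerivAt_id u).const_mul x)
      refine (a1.mul (Real.hasDerivAt_log hu0).neg).congr_deriv ?_
      simp only [Pi.neg_apply]
      field_simp
      ring)
    ((xsinc_log_intInt x).sub hI)
    (by
      have t := (tendsto_log_mul_rpow_nhdsGT_zero one_pos).abs.const_mul x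
      simp only [abs_zero, mul_zero, rpow_one] at t
      refine squeeze_zero_norm' ?_ t
      filter_upwards [self_mem_nhdsWithin] with u (hu : 0 < u)
      rw [norm_mul, norm_neg, norm_eq_abs, norm_eq_abs, abs_mul]
      have := Si_abs_le (x * u)
      rw [abs_mul, abs_of_pos hx] at this
      calc _ ≤ x * |u| * |log u| := by gcongr
        _ = _ := by ring)
    (by
      have : ContinuousAt (fun u => Si (x * u) * (-log u)) 1 := by
        refine ContinuousAt.mul (Si_continuous.comp (continuous_const.mul continuous_id)).continuousAt ?_
        exact (Real.continuousAt_log one_ne_zero).neg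
      have := this.tendsto
      simp only [log_one, neg_zero, mul_zero] at this
      exact this.mono_left nhdsWithin_le_nhds)
  rw [intervalIntegral.integral_sub (xsinc_log_intInt x) hI, h0] at h1
  linarith

lemma laplace_sin (a : ℝ) : ∫ s in Ioi (0:ℝ), exp (-s) * sin (a * s) = a / (1 + a ^ 2) := by
  have hpos : (0:ℝ) < 1 + a ^ 2 := by positivity
  have hexp : IntegrableOn (fun s : ℝ => exp (-s)) (Ioi 0) := integrableOn_exp_neg_Ioi 0
  have h := integral_Ioi_of_hasDerivAt_of_tendsto (a := 0) (m := 0)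
    (f := fun s => -(exp (-s) * (sin (a * s) + a * cos (a * s))) / (1 + a ^ 2))
    (f' := fun s => exp (-s) * sin (a * s))
    (by fun_prop)
    (by
      intro s _
      have e : HasDerivAt (fun s : ℝ => exp (-s)) (exp (-s) * -1) s :=
        (hasDerivAt_neg s).exp
      have m : HasDerivAt (fun s : ℝ => a * s) (a * 1) s := (hasDerivAt_id s).const_mul a
      refine ((e.mul (m.sin.add (m.cos.const_mul a))).neg.div_const (1 + a ^ 2)).congr_deriv ?_
      field_simp
      simp only [Pi.add_apply]
      ring)
    (by
      refine Integrable.mono' hexp (by fun_prop) ?_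
      filter_upwards with s
      rw [norm_mul, norm_eq_abs, norm_eq_abs, abs_exp]
      exact mul_le_of_le_one_right (exp_pos _).le (abs_sin_le_one _))
    (by
      have t : Tendsto (fun s : ℝ => exp (-s) * ((1 + |a|) / (1 + a ^ 2))) atTop (𝓝 (0 * ((1 + |a|) / (1 + a ^ 2)))) :=
        (tendsto_exp_neg_atTop_nhds_zero).mul_const _
      rw [zero_mul] at t
      refine squeeze_zero_norm (fun s => ?_) t
      rw [norm_eq_abs, abs_div, abs_neg, abs_mul, abs_exp, abs_of_pos hpos, mul_div_assoc]
      gcongr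
      refine (abs_add_le _ _).trans ?_
      rw [abs_mul]
      have := abs_sin_le_one (a * s)
      have := mul_le_of_le_one_right (abs_nonneg a) (abs_cos_le_one (a * s))
      linarith)
  rw [h]
  simp
  ring

lemma laplace_FF {y : ℝ} (hy : 0 < y) : ∫ s in Ioi (0:ℝ), exp (-s) * FF (y * s)
    = ∫ u in (0:ℝ)..1, y / (1 + (y * u) ^ 2) * (-log u) := by
  have e1 : ∫ s in Ioi (0:ℝ), exp (-s) * FF (y * s) = ∫ s in Ioi (0:ℝ), ∫ u in Ioc (0:ℝ) 1,
      exp (-s) * ((y * s) * sinc ((y * s) * u) * (-log u)) := by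
    refine setIntegral_congr_fun measurableSet_Ioi fun s (hs : 0 < s) => ?_
    rw [FF_eq (mul_pos hy hs), intervalIntegral.integral_of_le zero_le_one,
      MeasureTheory.integral_const_mul]
  rw [e1, integral_integral_swap, intervalIntegral.integral_of_le zero_le_one]
  · refine setIntegral_congr_fun measurableSet_Ioc fun u hu => ?_
    have hu0 : 0 < u := hu.1
    have : ∀ s ∈ Ioi (0:ℝ), exp (-s) * ((y * s) * sinc ((y * s) * u) * (-log u))
        = (exp (-s) * sin ((y * u) * s)) * (-log u / u) := by
      intro s (hs : 0 < s)
      rw [sinc_of_ne_zero (by positivity), show y * s * u = y * u * s by ring]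
      field_simp
    rw [setIntegral_congr_fun measurableSet_Ioi this, MeasureTheory.integral_mul_const, laplace_sin]
    field_simp
  · have i1 : Integrable (fun s : ℝ => y * (exp (-s) * s ^ (2 - 1 : ℝ))) (volume.restrict (Ioi 0)) :=
      (Real.GammaIntegral_convergent (s := 2) (by norm_num)).const_mul y
    have i2 : Integrable (fun u : ℝ => |log u|) (volume.restrict (Ioc 0 1)) := by
      have := (intervalIntegrable_log' (a := 0) (b := 1)).1
      exact Integrable.abs this
    have hm : Measurable sinc := continuous_sinc.measurable
    refine (i1.mul_prod i2).mono' (by unfold Function.uncurry; fun_prop) ?_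
    have : ∀ᵐ z ∂((volume.restrict (Ioi (0:ℝ))).prod (volume.restrict (Ioc (0:ℝ) 1))), 0 < z.1 := by
      have h := self_mem_ae_restrict (μ := (volume : Measure ℝ)) (measurableSet_Ioi (a := (0:ℝ)))
      exact Measure.quasiMeasurePreserving_fst.ae h
    filter_upwards [this] with z hz
    obtain ⟨s, u⟩ := z
    simp only [Function.uncurry, norm_mul, norm_eq_abs, abs_exp, abs_neg] at hz ⊢
    rw [abs_of_pos hy, abs_of_pos hz]
    have := abs_sinc_le_one (y * s * u)
    norm_num
    calc exp (-s) * (y * s * |sinc (y * s * u)| * |log u|)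
        ≤ exp (-s) * (y * s * 1 * |log u|) := by gcongr
      _ = _ := by ring

noncomputable def JJ (y : ℝ) : ℝ := ∫ v in (0:ℝ)..y, log v / (1 + v ^ 2)

lemma J_intInt (a b : ℝ) : IntervalIntegrable (fun v => log v / (1 + v ^ 2)) volume a b := by
  have h : IntervalIntegrable log volume a b := intervalIntegrable_log'
  have hc : Continuous (fun v : ℝ => (1 + v ^ 2)⁻¹) :=
    Continuous.inv₀ (by fun_prop) (fun v => by positivity)
  simpa only [div_eq_mul_inv] using h.mul_continuousOn hc.continuousOn

lemma JJ_continuous : Continuous JJ :=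
  intervalIntegral.continuous_primitive (fun a b => J_intInt a b) 0

lemma JJ_hasDerivAt {x : ℝ} (hx : 0 < x) : HasDerivAt JJ (log x / (1 + x ^ 2)) x := by
  have hm : Measurable (fun v => log v / (1 + v ^ 2)) := by fun_prop
  exact intervalIntegral.integral_hasDerivAt_right (J_intInt 0 x)
    (hm.stronglyMeasurable.stronglyMeasurableAtFilter)
    ((Real.continuousAt_log hx.ne').div (by fun_prop) (by positivity))

lemma JJ_inv {y : ℝ} (hy : 0 < y) : JJ y = JJ y⁻¹ := by
  have hd : ∀ x ∈ Ioi (0:ℝ), HasDerivAt (fun x => JJ x - JJ x⁻¹) 0 x := by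
    intro x (hx : 0 < x)
    have h1 : HasDerivAt (fun x => JJ x⁻¹) _ x :=
      (JJ_hasDerivAt (inv_pos.2 hx)).comp x (hasDerivAt_inv hx.ne')
    refine ((JJ_hasDerivAt hx).sub h1).congr_deriv ?_
    rw [log_inv]
    field_simp
    ring
  have := isOpen_Ioi.is_const_of_deriv_eq_zero (isPreconnected_Ioi (a := (0:ℝ)))
    (fun x hx => (hd x hx).differentiableAt.differentiableWithinAt)
    (fun x hx => (hd x hx).deriv) (mem_Ioi.2 hy) (mem_Ioi.2 one_pos)
  simp at this
  linarith

lemma JJ_tendsto : Tendsto JJ atTop (𝓝 0) := by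
  have h : Tendsto (fun y => JJ y⁻¹) atTop (𝓝 (JJ 0)) :=
    JJ_continuous.continuousAt.tendsto.comp tendsto_inv_atTop_zero
  have h0 : JJ 0 = 0 := by simp [JJ]
  rw [h0] at h
  refine h.congr' ?_
  filter_upwards [eventually_gt_atTop 0] with y hy
  exact (JJ_inv hy).symm

lemma laplace_FF' {y : ℝ} (hy : 0 < y) : ∫ s in Ioi (0:ℝ), exp (-s) * FF (y * s)
    = arctan y * log y - JJ y := by
  rw [laplace_FF hy]
  have hc : Continuous (fun v : ℝ => (1 + v ^ 2)⁻¹) :=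
    Continuous.inv₀ (by fun_prop) (fun v => by positivity)
  have h1 : ∫ u in (0:ℝ)..1, y / (1 + (y * u) ^ 2) * (-log u)
      = ∫ u in (0:ℝ)..1, (fun v => y * ((1 + v ^ 2)⁻¹ * log y - log v / (1 + v ^ 2))) (y * u) := by
    rw [intervalIntegral.integral_of_le zero_le_one, intervalIntegral.integral_of_le zero_le_one]
    refine setIntegral_congr_fun measurableSet_Ioc fun u hu => ?_
    have hu0 : 0 < u := hu.1
    simp only
    rw [log_mul hy.ne' hu0.ne']
    field_simp
    ring
  have hi : IntervalIntegrable (fun v : ℝ => (1 + v ^ 2)⁻¹ * log y) volume 0 y :=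
    (hc.mul continuous_const).intervalIntegrable _ _
  rw [h1, intervalIntegral.integral_comp_mul_left
    (fun v => y * ((1 + v ^ 2)⁻¹ * log y - log v / (1 + v ^ 2))) hy.ne', intervalIntegral.integral_const_mul,
    mul_zero, mul_one, intervalIntegral.integral_sub hi (J_intInt 0 y),
    intervalIntegral.integral_mul_const, integral_inv_one_add_sq, arctan_zero, sub_zero, smul_eq_mul]
  rw [← mul_assoc, inv_mul_cancel₀ hy.ne', one_mul]
  rfl

lemma key (L c : ℝ) (h : ∀ x, 1 ≤ x → |FF x - L * log x - c| ≤ 2 / x) :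
    Tendsto (fun y => (arctan y - L) * log y) atTop (𝓝 (c - L * eulerMascheroniConstant)) := by
  obtain ⟨M, hM, hD⟩ := D_bound L c h
  have hG := Real.GammaIntegral_convergent (s := 1/2) (by norm_num)
  have hexp : IntegrableOn (fun s : ℝ => exp (-s)) (Ioi 0) := integrableOn_exp_neg_Ioi 0
  have hb : ∀ y, 0 < y → |(arctan y * log y - JJ y) - L * log y
      + L * eulerMascheroniConstant - c| ≤
      M * y ^ (-(1/2) : ℝ) * ∫ s in Ioi (0:ℝ), exp (-s) * s ^ (1/2 - 1 : ℝ) := by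
    intro y hy
    have hDi : ∀ s ∈ Ioi (0:ℝ), ‖exp (-s) * (FF (y * s) - L * log (y * s) - c)‖
        ≤ M * y ^ (-(1/2) : ℝ) * (exp (-s) * s ^ (1/2 - 1 : ℝ)) := by
      intro s (hs : 0 < s)
      rw [norm_mul, norm_eq_abs, norm_eq_abs, abs_exp]
      have := hD (y * s) (mul_pos hy hs)
      rw [mul_rpow hy.le hs.le] at this
      rw [show (1/2 - 1 : ℝ) = -(1/2) by norm_num]
      calc _ ≤ exp (-s) * (M * (y ^ (-(1/2) : ℝ) * s ^ (-(1/2) : ℝ))) := by gcongr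
        _ = _ := by ring
    have hmF : Measurable FF := FF_continuous.measurable
    have i0 : IntegrableOn (fun s => exp (-s) * (FF (y * s) - L * log (y * s) - c)) (Ioi 0) := by
      refine Integrable.mono' (hG.const_mul (M * y ^ (-(1/2) : ℝ))) (by fun_prop) ?_
      filter_upwards [self_mem_ae_restrict measurableSet_Ioi] with s hs using hDi s hs
    have i1 := integrable_log_exp.const_mul L
    have i2 := hexp.const_mul (L * log y + c)
    have e : ∫ s in Ioi (0:ℝ), exp (-s) * FF (y * s) =
        (∫ s in Ioi (0:ℝ), exp (-s) * (FF (y * s) - L * log (y * s) - c))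
        + ((∫ s in Ioi (0:ℝ), L * (exp (-s) * log s))
        + ∫ s in Ioi (0:ℝ), (L * log y + c) * exp (-s)) := by
      have i3 : Integrable (fun s => L * (exp (-s) * log s) + (L * log y + c) * exp (-s))
        (volume.restrict (Ioi 0)) := i1.add i2
      rw [← integral_add i1 i2, ← integral_add i0 i3]
      refine setIntegral_congr_fun measurableSet_Ioi fun s (hs : 0 < s) => ?_
      rw [log_mul hy.ne' hs.ne']
      ring
    rw [MeasureTheory.integral_const_mul, MeasureTheory.integral_const_mul, integral_log_exp,
      integral_exp_neg_Ioi_zero, laplace_FF' hy] at e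
    have : (arctan y * log y - JJ y) - L * log y + L * eulerMascheroniConstant - c
      = ∫ s in Ioi (0:ℝ), exp (-s) * (FF (y * s) - L * log (y * s) - c) := by
      rw [e]; ring
    rw [this, ← MeasureTheory.integral_const_mul, ← norm_eq_abs]
    refine norm_integral_le_of_norm_le (hG.const_mul (M * y ^ (-(1/2) : ℝ))) ?_
    filter_upwards [self_mem_ae_restrict measurableSet_Ioi] with s hs using hDi s hs
  have t0 := ((tendsto_rpow_neg_atTop (show (0:ℝ) < 1/2 by norm_num)).const_mul M).mul_const
    (∫ s in Ioi (0:ℝ), exp (-s) * s ^ (1/2 - 1 : ℝ))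
  rw [mul_zero, zero_mul] at t0
  have t1 : Tendsto (fun y => (arctan y * log y - JJ y) - L * log y
      + L * eulerMascheroniConstant - c) atTop (𝓝 0) := by
    refine squeeze_zero_norm' ?_ t0
    filter_upwards [eventually_gt_atTop 0] with y hy using hb y hy
  have t2 := (t1.add JJ_tendsto).add_const (c - L * eulerMascheroniConstant)
  rw [add_zero, zero_add] at t2
  refine t2.congr fun y => ?_
  ring

lemma arctan_log_tendsto : Tendsto (fun y => (arctan y - π / 2) * log y) atTop (𝓝 0) := by
  have t : Tendsto (fun y : ℝ => log y / y) atTop (𝓝 0) := by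
    simpa using tendsto_pow_log_div_mul_add_atTop 1 0 1 one_ne_zero
  refine squeeze_zero_norm' ?_ t
  filter_upwards [eventually_ge_atTop 1] with y hy
  have hy0 : 0 < y := by linarith
  have h1 := arctan_inv_of_pos hy0
  have h2 : arctan y⁻¹ ≤ y⁻¹ := by
    have a1 : 0 < arctan y⁻¹ := arctan_pos.2 (inv_pos.2 hy0)
    have := (lt_tan a1 (arctan_lt_pi_div_two _)).le
    rwa [tan_arctan] at this
  have h3 : 0 ≤ arctan y⁻¹ := arctan_nonneg.2 (inv_pos.2 hy0).le
  rw [show arctan y - π / 2 = - arctan y⁻¹ by linarith, norm_mul, norm_neg, norm_of_nonneg h3,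
    norm_of_nonneg (log_nonneg hy), div_eq_inv_mul]
  gcongr
  exact log_nonneg hy

theorem integral_Si_div_asymptotics :
    ∃ C > (0 : ℝ), ∃ X > (0 : ℝ), ∀ x : ℝ, X ≤ x →
      |(∫ t in (0 : ℝ)..x, Si t / t) - (Real.pi / 2) * Real.log x
          - Real.eulerMascheroniConstant * Real.pi / 2| ≤ C / x := by
  obtain ⟨L, c, h⟩ := exists_c
  have hk := key L c h
  have hinv : Tendsto (fun y : ℝ => (log y)⁻¹) atTop (𝓝 0) :=
    tendsto_inv_atTop_zero.comp tendsto_log_atTop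
  have hL : L = π / 2 := by
    have t := hk.mul hinv
    rw [mul_zero] at t
    have t' : Tendsto (fun y => arctan y - L) atTop (𝓝 0) := by
      refine t.congr' ?_
      filter_upwards [eventually_gt_atTop 1] with y hy
      have := (log_pos hy).ne'
      field_simp
    have t2 : Tendsto (fun y => arctan y - L) atTop (𝓝 (π / 2 - L)) :=
      (tendsto_arctan_atTop.mono_right nhdsWithin_le_nhds).sub_const L
    have := tendsto_nhds_unique t' t2
    linarith
  subst hL
  have hc := tendsto_nhds_unique hk arctan_log_tendsto
  refine ⟨2, by norm_num, 1, by norm_num, fun x hx => ?_⟩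
  have := h x hx
  rw [show Real.eulerMascheroniConstant * Real.pi / 2 = c by linarith]
  exact this
end
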